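/- For every integer k ≥ 2 and every real ω ≥ 1.1, ((k²-1)/2)·ω + 2·sin(ω) - 2k·sin(kω) > 0. -/

import Mathlib

open Real in
/-- The case `k = 2` on the first quadrant, where the inequality is tightest. -/
theorem hk_pos_two_of_le_pi_div_two {ω : ℝ} (hω : 1.1 ≤ ω) (h : ω ≤ π / 2) :
    0 < 3 / 2 * ω + 2 * sin ω - 4 * sin (2 * ω) := by
  have hcos : cos ω < 0.456 := by
    rw [← sin_pi_div_two_sub]
    have hpi := pi_lt_d4
    norm_num at hpi hω
    have hmono : sin (π / 2 - ω) ≤ sin 0.4708 :=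
      sin_le_sin_of_le_of_le_pi_div_two (by linarith) (by linarith [pi_gt_three]) (by linarith)
    have hbound := (abs_le.mp (sin_bound (x := 0.4708) (by norm_num [abs_le]))).2
    rw [abs_of_pos (by norm_num)] at hbound
    norm_num at hbound hmono ⊢
    linarith
  have hsin : 0 ≤ sin ω := sin_nonneg_of_nonneg_of_le_pi (by linarith) (by linarith [pi_pos])
  rw [sin_two_mul]
  norm_num at hω hcos
  linarith [sin_le_one ω, mul_le_mul_of_nonneg_left hcos.le hsin]

open Real in
theorem hk_pos_two {ω : ℝ} (hω : 1.1 ≤ ω) :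
    0 < 3 / 2 * ω + 2 * sin ω - 4 * sin (2 * ω) := by
  rcases le_or_gt ω (π / 2) with h₁ | h₁
  · exact hk_pos_two_of_le_pi_div_two hω h₁
  have hpi := pi_gt_d2
  norm_num at hpi hω
  rcases le_or_gt ω π with h₂ | h₂
  · have hsin : 0 ≤ sin ω := sin_nonneg_of_nonneg_of_le_pi (by linarith) h₂
    have hcos : cos ω ≤ 0 := cos_nonpos_of_pi_div_two_le_of_le h₁.le (by linarith)
    rw [sin_two_mul]
    nlinarith [mul_nonneg hsin (neg_nonneg.mpr hcos)]
  rcases le_or_gt ω 4 with h₃ | h₃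
  · have hsin : sin (ω - π) ≤ ω - π := sin_le (by linarith)
    rw [sin_sub_pi] at hsin
    linarith [sin_le_one (2 * ω)]
  · linarith [sin_le_one (2 * ω), neg_one_le_sin ω]

open Real in
theorem sin_nonpos_of_pi_le_of_le_two_pi {x : ℝ} (h₁ : π ≤ x) (h₂ : x ≤ 2 * π) : sin x ≤ 0 := by
  have := sin_nonneg_of_nonneg_of_le_pi (x := x - π) (by linarith) (by linarith)
  rw [sin_sub_pi] at this
  linarith

theorem hk_pos (k : ℕ) (hk : 2 ≤ k) (ω : ℝ) (hω : 1.1 ≤ ω) :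
    0 < ((k : ℝ) ^ 2 - 1) / 2 * ω + 2 * Real.sin ω - 2 * k * Real.sin (k * ω) := by
  have hω' : 11 / 10 ≤ ω := by norm_num at hω; exact hω
  have hpi := Real.pi_gt_d2
  have hpi' := Real.pi_lt_d2
  norm_num at hpi hpi'
  have hlow := Real.neg_one_le_sin ω
  have hup := Real.sin_le_one (k * ω)
  obtain rfl | rfl | rfl | hk5 : k = 2 ∨ k = 3 ∨ k = 4 ∨ 5 ≤ k := by omega
  · have := hk_pos_two hω
    push_cast
    linarith
  · push_cast at hup ⊢
    rcases le_or_gt ω 2 with h | h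
    · have := sin_nonpos_of_pi_le_of_le_two_pi (x := 3 * ω) (by linarith) (by linarith)
      linarith
    · linarith
  · push_cast at hup ⊢
    rcases le_or_gt ω (3 / 2) with h | h
    · have := sin_nonpos_of_pi_le_of_le_two_pi (x := 4 * ω) (by linarith) (by linarith)
      linarith
    · linarith
  · have hk5' : (5 : ℝ) ≤ k := by exact_mod_cast hk5
    have hsin : 2 * (k : ℝ) * Real.sin (k * ω) ≤ 2 * k :=
      mul_le_of_le_one_right (by positivity) hup
    have hmul : ((k : ℝ) ^ 2 - 1) / 2 * (11 / 10) ≤ ((k : ℝ) ^ 2 - 1) / 2 * ω :=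
      mul_le_mul_of_nonneg_left hω' (by nlinarith)
    nlinarith
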